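/- arXiv:1311.2799 — 2 statements merged into one kernel-verified Lean document; each statement's English description precedes it below -/
import Mathlib

section
/- Fix δ ∈ (0,1), ν > 0, B > 0, an integer M ≥ 3, vectors μ_1,…,μ_M ∈ ℝⁿ with max_{j∈[M]} ‖μ_j‖² ≤ B², and μ ∈ ℝⁿ. Then for every q ∈ (0,1] and every θ ∈ ℝ^M with θ ≠ 0, min_{θ'∈ℝ^M} { ‖μ_{θ'} − μ‖² + ν²·|θ'|₀·log(2eM/(|θ'|₀·δ)) } ≤ ‖μ_θ − μ‖² + φ_{q,M}(θ; ν, B). -/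
open MeasureTheory ProbabilityTheory Real
open scoped RealInnerProductSpace ENNReal

/-- `loḡ(x) = max(log x, 1)`. -/
noncomputable def olog (x : ℝ) : ℝ := max (Real.log x) 1

/-- `|β|₀` with the convention `|0|₀ = 1`, as a real number. -/
noncomputable def zeroNorm {p : ℕ} (β : Fin p → ℝ) : ℝ :=
  max 1 ((Finset.univ.filter fun i => β i ≠ 0).card : ℝ)

/-- The remainder term `φ_{q,M}(θ; ν, B)` (with confidence level `δ`):
`max( 17 ν^{2-q} B^q |θ|_q^q [loḡ(eMν^q/(B^q|θ|_q^q δ))]^{1-q/2} , 3 ν² loḡ(eM/δ) )`. -/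
noncomputable def phi (M : ℕ) (δ : ℝ) (q : ℝ) (ν B : ℝ) (θ : Fin M → ℝ) : ℝ :=
  max
    (17 * ν ^ (2 - q) * B ^ q * (∑ j, |θ j| ^ q) *
      (olog (Real.exp 1 * M * ν ^ q / (B ^ q * (∑ j, |θ j| ^ q) * δ))) ^ (1 - q / 2))
    (3 * ν ^ (2 : ℕ) * olog (Real.exp 1 * M / δ))

/-- Rounding a scalar coefficient `y` to `0`, to `±τ` or to itself, at controlled cost in the
penalized squared norm. -/
theorem exists_rounding_coeff {E : Type*} [NormedAddCommGroup E] [InnerProductSpace ℝ E]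
    (v w : E) {B τ c q : ℝ} (hτ : 0 < τ) (hc : 0 ≤ c) (hq0 : 0 < q) (hq1 : q ≤ 1)
    (hw : ‖w‖ ^ 2 ≤ B ^ 2) (y : ℝ) :
    ∃ x : ℝ, ‖v + x • w‖ ^ 2 + c * (if x ≠ 0 then 1 else 0) ≤
      ‖v + y • w‖ ^ 2 + (B ^ 2 * τ ^ 2 + c) * (|y| / τ) ^ q := by
  rcases le_or_gt τ |y| with hy | hy
  · refine ⟨y, ?_⟩
    have h1 : 1 ≤ (|y| / τ) ^ q := Real.one_le_rpow ((one_le_div hτ).2 hy) hq0.le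
    have h2 : (if y ≠ 0 then (1 : ℝ) else 0) ≤ 1 := by split_ifs <;> norm_num
    have h3 := mul_le_mul_of_nonneg_left (h2.trans h1) hc
    have h4 : 0 ≤ B ^ 2 * τ ^ 2 * (|y| / τ) ^ q := by positivity
    linarith
  · set p := |y| / τ with hp
    have hp0 : 0 ≤ p := by positivity
    have hp1 : p < 1 := (div_lt_one hτ).2 hy
    have hpq : p ≤ p ^ q := by
      simpa using Real.rpow_le_rpow_of_exponent_ge' hp0 hp1.le hq0.le hq1
    obtain ⟨a, ha2, hpa⟩ : ∃ a : ℝ, a ^ 2 = τ ^ 2 ∧ p * a = y := by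
      rcases le_total 0 y with h | h
      · exact ⟨τ, rfl, by rw [hp, abs_of_nonneg h]; field_simp⟩
      · exact ⟨-τ, by ring, by rw [hp, abs_of_nonpos h]; field_simp⟩
    have expand : ∀ x : ℝ,
        ‖v + x • w‖ ^ 2 = ‖v‖ ^ 2 + 2 * x * inner ℝ v w + x ^ 2 * ‖w‖ ^ 2 := by
      intro x
      rw [norm_add_sq_real, inner_smul_right, norm_smul, mul_pow, Real.norm_eq_abs, sq_abs]
      ring
    have hvar : p * (1 - p) * τ ^ 2 * ‖w‖ ^ 2 ≤ B ^ 2 * τ ^ 2 * p ^ q := by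
      have h1 : p * (1 - p) ≤ p ^ q := by nlinarith
      have h2 : 0 ≤ p ^ q := by positivity
      calc p * (1 - p) * τ ^ 2 * ‖w‖ ^ 2 = (p * (1 - p)) * (τ ^ 2 * ‖w‖ ^ 2) := by ring
        _ ≤ p ^ q * (τ ^ 2 * B ^ 2) := by gcongr
        _ = _ := by ring
    have hmean : p * ‖v + a • w‖ ^ 2 + (1 - p) * ‖v‖ ^ 2 =
        ‖v + y • w‖ ^ 2 + p * (1 - p) * τ ^ 2 * ‖w‖ ^ 2 := by
      rw [expand, expand, ← hpa, ← ha2]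
      ring
    have hcp : c * p ≤ c * p ^ q := mul_le_mul_of_nonneg_left hpq hc
    by_contra! hcon
    have h0 := hcon 0
    have h1 := hcon a
    have h2 : c * (if a ≠ 0 then (1 : ℝ) else 0) ≤ c := by split_ifs <;> linarith
    simp only [ne_eq, not_true_eq_false, if_false, mul_zero, add_zero, zero_smul] at h0
    have h3 : (‖v + y • w‖ ^ 2 + (B ^ 2 * τ ^ 2 + c) * p ^ q) * p
        ≤ (‖v + a • w‖ ^ 2 + c) * p := mul_le_mul_of_nonneg_right (by linarith) hp0
    have h4 := mul_lt_mul_of_pos_right h0 (sub_pos.2 hp1)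
    linarith

/-- Coordinatewise sparsification of a linear combination under an `ℓ_q` budget. -/
theorem exists_sparse_combination {E ι : Type*} [Fintype ι] [NormedAddCommGroup E]
    [InnerProductSpace ℝ E] (w : ι → E) (u : E) {B τ c q : ℝ} (hτ : 0 < τ) (hc : 0 ≤ c)
    (hq0 : 0 < q) (hq1 : q ≤ 1) (hw : ∀ j, ‖w j‖ ^ 2 ≤ B ^ 2) (θ : ι → ℝ) :
    ∃ θ' : ι → ℝ, ‖∑ j, θ' j • w j - u‖ ^ 2 + c * ((Finset.univ.filter fun j => θ' j ≠ 0).card : ℝ)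
      ≤ ‖∑ j, θ j • w j - u‖ ^ 2 + (B ^ 2 * τ ^ 2 + c) * ∑ j, (|θ j| / τ) ^ q := by
  classical
  have key : ∀ s : Finset ι, ∀ u : E, ∃ θ' : ι → ℝ,
      ‖∑ j ∈ s, θ' j • w j - u‖ ^ 2 + c * ∑ j ∈ s, (if θ' j ≠ 0 then (1 : ℝ) else 0)
        ≤ ‖∑ j ∈ s, θ j • w j - u‖ ^ 2 + (B ^ 2 * τ ^ 2 + c) * ∑ j ∈ s, (|θ j| / τ) ^ q := by
    intro s
    induction s using Finset.induction_on with
    | empty => intro u; exact ⟨0, by simp⟩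
    | insert i s hi ih =>
      intro u
      obtain ⟨θ', h⟩ := ih (u - θ i • w i)
      obtain ⟨x, hx⟩ := exists_rounding_coeff (∑ j ∈ s, θ' j • w j - u) (w i) hτ hc hq0 hq1
        (hw i) (θ i)
      refine ⟨Function.update θ' i x, ?_⟩
      have hne : ∀ j ∈ s, Function.update θ' i x j = θ' j := fun j hj =>
        Function.update_of_ne (ne_of_mem_of_not_mem hj hi) _ _
      have e1 : ∑ j ∈ s, Function.update θ' i x j • w j = ∑ j ∈ s, θ' j • w j :=
        Finset.sum_congr rfl fun j hj => by rw [hne j hj]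
      have e2 : ∑ j ∈ s, (if Function.update θ' i x j ≠ 0 then (1 : ℝ) else 0)
          = ∑ j ∈ s, (if θ' j ≠ 0 then (1 : ℝ) else 0) :=
        Finset.sum_congr rfl fun j hj => by rw [hne j hj]
      simp only [Finset.sum_insert hi]
      rw [e1, e2, Function.update_self,
        show x • w i + ∑ j ∈ s, θ' j • w j - u = ∑ j ∈ s, θ' j • w j - u + x • w i by abel,
        show θ i • w i + ∑ j ∈ s, θ j • w j - u = ∑ j ∈ s, θ j • w j - (u - θ i • w i) by abel]
      rw [show ∑ j ∈ s, θ' j • w j - (u - θ i • w i)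
        = ∑ j ∈ s, θ' j • w j - u + θ i • w i by abel] at h
      linarith
  obtain ⟨θ', h⟩ := key Finset.univ u
  exact ⟨θ', by simpa only [Finset.sum_boole] using h⟩

/-- Affine upper bound in the support size `N` for the entropic penalty `x log (C / x)` at
`x = max 1 N`. -/
theorem max_one_mul_log_div_le {C K c : ℝ} (hC : 1 ≤ C) (hK : 0 < K) (hc : Real.log (C / K) - 1 ≤ c)
    (N : ℕ) :
    max 1 (N : ℝ) * Real.log (C / max 1 (N : ℝ)) ≤ Real.log C + K + c * N := by
  have hlC := Real.log_nonneg hC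
  rcases Nat.eq_zero_or_pos N with rfl | hN
  · simp [hK.le]
  · have hN1 : (1 : ℝ) ≤ N := by exact_mod_cast hN
    have hN0 : (0 : ℝ) < N := by linarith
    rw [max_eq_right hN1]
    have e : Real.log (C / N) = Real.log (C / K) + Real.log (K / N) := by
      rw [← Real.log_mul (by positivity) (by positivity)]
      congr 1
      field_simp
    have h1 : Real.log (K / N) ≤ K / N - 1 := Real.log_le_sub_one_of_pos (by positivity)
    calc (N : ℝ) * Real.log (C / N) ≤ N * (c + K / N) := by
          gcongr
          linarith
      _ = K + c * N := by field_simp; ring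
      _ ≤ _ := by linarith

theorem stmt_11
    (n M : ℕ) (hM : 3 ≤ M)
    (δ : ℝ) (hδ : δ ∈ Set.Ioo (0 : ℝ) 1)
    (ν : ℝ) (hν : 0 < ν) (B : ℝ) (hB : 0 < B)
    (μs : Fin M → EuclideanSpace ℝ (Fin n)) (hμs : ∀ j, ‖μs j‖ ^ 2 ≤ B ^ 2)
    (μ : EuclideanSpace ℝ (Fin n))
    (q : ℝ) (hq : q ∈ Set.Ioc (0 : ℝ) 1)
    (θ : Fin M → ℝ) (hθ : θ ≠ 0) :
    ∃ θ' : Fin M → ℝ,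
      ‖(∑ j, θ' j • μs j) - μ‖ ^ 2
          + ν ^ 2 * zeroNorm θ' * Real.log (2 * Real.exp 1 * M / (zeroNorm θ' * δ)) ≤
        ‖(∑ j, θ j • μs j) - μ‖ ^ 2 + phi M δ q ν B θ := by
  obtain ⟨hδ0, hδ1⟩ := hδ
  obtain ⟨hq0, hq1⟩ := hq
  have hM3 : (3 : ℝ) ≤ M := by exact_mod_cast hM
  have hM0 : (0 : ℝ) < M := by linarith
  set S := ∑ j, |θ j| ^ q with hS
  have hS0 : 0 < S := by
    obtain ⟨i, hi⟩ := Function.ne_iff.1 hθ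
    exact Finset.sum_pos' (fun j _ => by positivity)
      ⟨i, Finset.mem_univ i, Real.rpow_pos_of_pos (abs_pos.2 hi) q⟩
  set R := Real.exp 1 * M * ν ^ q / (B ^ q * S * δ) with hR
  have hR0 : 0 < R := by positivity
  set l := olog R with hl
  have hl1 : 1 ≤ l := le_max_right _ _
  have hlR : Real.log R ≤ l := le_max_left _ _
  have hl0 : 0 < l := by linarith
  set τ := ν * Real.sqrt l / B with hτ
  have hτ0 : 0 < τ := by positivity
  have hBτ : B ^ 2 * τ ^ 2 = ν ^ 2 * l := by
    rw [hτ, div_pow, mul_pow, Real.sq_sqrt hl0.le]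
    field_simp
  have hτq : τ ^ q = ν ^ q * l ^ (q / 2) / B ^ q := by
    rw [hτ, Real.div_rpow (by positivity) hB.le, Real.mul_rpow hν.le (by positivity),
      Real.sqrt_eq_rpow, ← Real.rpow_mul hl0.le]
    ring_nf
  set K := S / τ ^ q with hK
  have hK0 : 0 < K := by positivity
  have hsum : ∑ j, (|θ j| / τ) ^ q = K := by
    rw [hK, hS, Finset.sum_div]
    exact Finset.sum_congr rfl fun j _ => Real.div_rpow (abs_nonneg _) hτ0.le q
  set Y := Real.log (Real.exp 1 * M / δ) with hY
  have hY2 : 2 ≤ Y := by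
    rw [hY, Real.le_log_iff_exp_le (by positivity), show (2 : ℝ) = 1 + 1 by norm_num, Real.exp_add,
      mul_div_assoc]
    have h1 : (M : ℝ) ≤ M / δ := le_div_self hM0.le hδ0 hδ1.le
    have h2 : Real.exp 1 ≤ M / δ := by linarith [Real.exp_one_lt_d9]
    gcongr
  set C := 2 * Real.exp 1 * M / δ with hC
  have hlogC : Real.log C = Real.log 2 + Y := by
    rw [hY, ← Real.log_mul (by norm_num) (by positivity)]
    congr 1
    rw [hC]
    ring
  have hC1 : 1 ≤ C := by
    have h := Real.log_two_gt_d9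
    by_contra! hlt
    have := Real.log_nonpos (x := C) (by positivity) hlt.le
    linarith
  have hlogCK : Real.log (C / K) - 1 ≤ 3 / 2 * l := by
    have e : C / K = 2 * R * l ^ (q / 2) := by
      rw [hK, hτq, hC, hR]
      field_simp
    rw [e, Real.log_mul (by positivity) (by positivity), Real.log_mul (by norm_num) hR0.ne',
      Real.log_rpow hl0]
    have h1 := Real.log_two_lt_d9
    have h2 : Real.log l ≤ l - 1 := Real.log_le_sub_one_of_pos hl0
    nlinarith
  have hX : ν ^ (2 - q) * B ^ q * S * l ^ (1 - q / 2) = ν ^ 2 * l * K := by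
    rw [hK, hτq, Real.rpow_sub hν, Real.rpow_sub hl0, Real.rpow_one, Real.rpow_two]
    field_simp
  obtain ⟨θ', h⟩ := exists_sparse_combination μs μ (c := ν ^ 2 * (3 / 2 * l)) hτ0 (by positivity)
    hq0 hq1 hμs θ
  refine ⟨θ', ?_⟩
  have hpen := mul_le_mul_of_nonneg_left (max_one_mul_log_div_le hC1 hK0 hlogCK
    (Finset.univ.filter fun j => θ' j ≠ 0).card) (sq_nonneg ν)
  rw [hBτ, hsum] at h
  have hdiv : 2 * Real.exp 1 * M / (zeroNorm θ' * δ) = C / zeroNorm θ' := by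
    rw [hC, div_div, mul_comm δ]
  have hphi : max (17 * (ν ^ 2 * l * K)) (3 * ν ^ 2 * Y) ≤ phi M δ q ν B θ := by
    unfold phi
    rw [← hS, ← hR, ← hl, ← hX]
    refine max_le_max (le_of_eq (by ring)) ?_
    gcongr
    exact le_max_left _ _
  have hp1 := (le_max_left _ _).trans hphi
  have hp2 := (le_max_right _ _).trans hphi
  have hν2 : 0 < ν ^ 2 := by positivity
  have hlogC' : ν ^ 2 * Real.log C ≤ ν ^ 2 * (3 / 2 * Y) := by
    gcongr
    linarith [Real.log_two_lt_d9]
  have hKl : ν ^ 2 * K ≤ ν ^ 2 * l * K := by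
    have := mul_le_mul_of_nonneg_left hl1 (mul_pos hν2 hK0).le
    linarith
  have hYpos : 0 ≤ ν ^ 2 * Y := by positivity
  rw [hdiv, mul_assoc]
  unfold zeroNorm
  linarith
end

section
/- Let μ_1,…,μ_M ∈ ℝⁿ satisfy max_{j∈[M]} ‖μ_j‖² ≤ B² for some B > 0. Then for every μ ∈ ℝⁿ, every q ∈ (0,1], every θ ∈ ℝ^M, and every positive integer m with m ≤ M/2, there exists θ^m ∈ ℝ^M such that |θ^m|₀ ≤ 2m and ‖μ_{θ^m} − μ‖² ≤ ‖μ_θ − μ‖² + B²·|θ|_q²·m^{1 − 2/q}. -/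
theorem exists_card_eq_forall_notMem_le {ι : Type*} [Fintype ι] (f : ι → ℝ) (k : ℕ)
    (hk : k ≤ Fintype.card ι) :
    ∃ S : Finset ι, S.card = k ∧ ∀ i ∈ S, ∀ j ∉ S, f j ≤ f i := by
  classical
  induction k with
  | zero => exact ⟨∅, by simp⟩
  | succ k ih =>
    obtain ⟨S, hS, h⟩ := ih (by omega)
    have hne : Sᶜ.Nonempty := by
      rw [← Finset.card_pos, Finset.card_compl]
      omega
    obtain ⟨a, ha, hmax⟩ := Finset.exists_max_image Sᶜ f hne
    have ha' : a ∉ S := by simpa using ha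
    refine ⟨insert a S, by rw [Finset.card_insert_of_notMem ha', hS], fun i hi j hj => ?_⟩
    rw [Finset.mem_insert, not_or] at hj
    rcases Finset.mem_insert.1 hi with rfl | hi
    · exact hmax j (by simpa using hj.2)
    · exact h i hi j hj.2

/-- The `ℓ¹` norm of a vector outside its `m` largest coordinates is bounded by its `ℓ^q`
quasinorm. -/
theorem sum_abs_compl_le_of_forall_notMem_le {ι : Type*} [Fintype ι] [DecidableEq ι]
    (θ : ι → ℝ) {q : ℝ}
    (hq : q ∈ Set.Ioc (0 : ℝ) 1) {m : ℕ} (hm : 1 ≤ m) {S : Finset ι} (hS : S.card = m)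
    (h : ∀ i ∈ S, ∀ j ∉ S, |θ j| ≤ |θ i|) :
    ∑ j ∈ Sᶜ, |θ j| ≤ (∑ j, |θ j| ^ q) ^ (1 / q) * (m : ℝ) ^ (1 - 1 / q) := by
  obtain ⟨hq0, hq1⟩ := hq
  have hm0 : (0 : ℝ) < m := by exact_mod_cast hm
  have hx0 : ∀ j, 0 ≤ |θ j| ^ q := fun j => by positivity
  set s := ∑ j, |θ j| ^ q with hs
  have hs0 : 0 ≤ s := Finset.sum_nonneg fun j _ => hx0 j
  have hr : 1 ≤ 1 / q := (one_le_div hq0).2 hq1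
  set r := 1 / q with hrdef
  have hpow : ∀ y : ℝ, 0 ≤ y → y ^ r = y * y ^ (r - 1) := fun y hy => by
    rw [← Real.rpow_one_add' hy (by linarith)]
    congr 1
    ring
  have hle : ∀ j ∈ Sᶜ, |θ j| ≤ |θ j| ^ q * (s / m) ^ (r - 1) := fun j hj => by
    have hj' : j ∉ S := by simpa using hj
    have hxs : |θ j| ^ q ≤ s / m := by
      rw [le_div_iff₀ hm0]
      calc |θ j| ^ q * m = ∑ i ∈ S, |θ j| ^ q := by
            rw [Finset.sum_const, hS, nsmul_eq_mul, mul_comm]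
        _ ≤ ∑ i ∈ S, |θ i| ^ q := Finset.sum_le_sum fun i hi =>
            Real.rpow_le_rpow (abs_nonneg _) (h i hi j hj') hq0.le
        _ ≤ s := Finset.sum_le_univ_sum_of_nonneg hx0
    calc |θ j| = (|θ j| ^ q) ^ r := by
          rw [← Real.rpow_mul (abs_nonneg _), hrdef, mul_one_div_cancel hq0.ne', Real.rpow_one]
      _ = |θ j| ^ q * (|θ j| ^ q) ^ (r - 1) := hpow _ (hx0 j)
      _ ≤ _ := mul_le_mul_of_nonneg_left
          (Real.rpow_le_rpow (hx0 j) hxs (by linarith)) (hx0 j)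
  calc ∑ j ∈ Sᶜ, |θ j| ≤ ∑ j ∈ Sᶜ, |θ j| ^ q * (s / m) ^ (r - 1) := Finset.sum_le_sum hle
    _ = (∑ j ∈ Sᶜ, |θ j| ^ q) * (s / m) ^ (r - 1) := by rw [Finset.sum_mul]
    _ ≤ s * (s / m) ^ (r - 1) := mul_le_mul_of_nonneg_right
        (Finset.sum_le_univ_sum_of_nonneg hx0) (by positivity)
    _ = s ^ r * (m : ℝ) ^ (1 - r) := by
        rw [Real.div_rpow hs0 hm0.le, hpow s hs0, show 1 - r = -(r - 1) by ring,
          Real.rpow_neg hm0.le]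
        ring

section Maurey

variable {ι E : Type*} [Fintype ι] [NormedAddCommGroup E] [InnerProductSpace ℝ E]

open Classical in
/-- One derandomized step of Maurey's sampling argument. -/
theorem exists_norm_add_sum_smul_sub_sum_sq_le (v : ι → E) {B : ℝ} (hv : ∀ j, ‖v j‖ ^ 2 ≤ B ^ 2)
    (ζ : ι → ℝ) (u : E) :
    ∃ c : ι → ℝ, (Finset.univ.filter fun i => c i ≠ 0).card ≤ 1 ∧
      ‖u + (∑ i, c i • v i - ∑ i, ζ i • v i)‖ ^ 2 ≤ ‖u‖ ^ 2 + B ^ 2 * (∑ i, |ζ i|) ^ 2 := by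
  set t := ∑ i, |ζ i| with ht
  set w := ∑ i, ζ i • v i with hw
  have ht0 : 0 ≤ t := Finset.sum_nonneg fun i _ => abs_nonneg _
  rcases ht0.eq_or_lt with h0 | hpos
  · have hz : ∀ i, ζ i = 0 := fun i => by
      have := (Finset.sum_eq_zero_iff_of_nonneg fun i _ => abs_nonneg (ζ i)).1 (ht.symm.trans h0.symm)
        i (Finset.mem_univ i)
      simpa using this
    refine ⟨0, by simp, ?_⟩
    have hw0 : w = 0 := by simp [hw, hz]
    simp [hw0, ← h0]
  set x : ι → E := fun i => (t * SignType.sign (ζ i) : ℝ) • v i with hx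
  have hxw : ∑ i, |ζ i| • x i = t • w := by
    rw [hw, Finset.smul_sum]
    refine Finset.sum_congr rfl fun i _ => ?_
    simp only [hx, smul_smul]
    congr 1
    rw [mul_left_comm, abs_mul_sign]
  have hxn : ∀ i, ‖x i‖ ^ 2 ≤ B ^ 2 * t ^ 2 := fun i => by
    have hsg : ‖((SignType.sign (ζ i) : SignType) : ℝ)‖ ^ 2 ≤ 1 := by
      rcases lt_trichotomy (ζ i) 0 with h | h | h <;> simp [h]
    rw [hx, norm_smul, norm_mul, mul_pow, mul_pow, Real.norm_eq_abs t, sq_abs]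
    nlinarith [hv i, mul_le_mul hsg (hv i) (sq_nonneg _) zero_le_one, sq_nonneg t]
  obtain ⟨i, hi⟩ : ∃ i, ‖u + (x i - w)‖ ^ 2 ≤ ‖u‖ ^ 2 + B ^ 2 * t ^ 2 := by
    by_contra! hcon
    have hexp : ∀ i, ‖u + (x i - w)‖ ^ 2
        = ‖u - w‖ ^ 2 + 2 * inner ℝ (u - w) (x i) + ‖x i‖ ^ 2 := fun i => by
      rw [← norm_add_sq_real]
      congr 2
      abel
    have hsum : ∑ i, |ζ i| * ‖u + (x i - w)‖ ^ 2
        ≤ t * (‖u‖ ^ 2 + B ^ 2 * t ^ 2) := by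
      have hin : ∑ i, |ζ i| * inner ℝ (u - w) (x i) = t * inner ℝ (u - w) w := by
        rw [← real_inner_smul_right, ← hxw, inner_sum]
        simp only [real_inner_smul_right]
      have h2 : ∑ i, |ζ i| * ‖x i‖ ^ 2 ≤ t * (B ^ 2 * t ^ 2) := by
        rw [ht, Finset.sum_mul]
        exact Finset.sum_le_sum fun i _ => mul_le_mul_of_nonneg_left (hxn i) (abs_nonneg _)
      have huw : ‖u‖ ^ 2 = ‖u - w‖ ^ 2 + 2 * inner ℝ (u - w) w + ‖w‖ ^ 2 := by
        rw [← norm_add_sq_real, sub_add_cancel]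
      calc ∑ i, |ζ i| * ‖u + (x i - w)‖ ^ 2
          = t * ‖u - w‖ ^ 2 + 2 * ∑ i, |ζ i| * inner ℝ (u - w) (x i)
              + ∑ i, |ζ i| * ‖x i‖ ^ 2 := by
            rw [ht, Finset.sum_mul, Finset.mul_sum, ← Finset.sum_add_distrib,
              ← Finset.sum_add_distrib]
            refine Finset.sum_congr rfl fun i _ => ?_
            rw [hexp]
            ring
        _ ≤ _ := by
            rw [hin, huw]
            nlinarith [mul_nonneg ht0 (sq_nonneg ‖w‖)]
    have hlt : t * (‖u‖ ^ 2 + B ^ 2 * t ^ 2) < ∑ i, |ζ i| * ‖u + (x i - w)‖ ^ 2 := by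
      obtain ⟨i, hi, hne⟩ := Finset.exists_ne_zero_of_sum_ne_zero (ht ▸ hpos.ne')
      conv_lhs => rw [ht, Finset.sum_mul]
      exact Finset.sum_lt_sum
        (fun i _ => mul_le_mul_of_nonneg_left (hcon i).le (abs_nonneg _))
        ⟨i, hi, mul_lt_mul_of_pos_left (hcon i) ((abs_nonneg _).lt_of_ne' hne)⟩
    exact hlt.not_ge hsum
  refine ⟨Pi.single i (t * SignType.sign (ζ i)), ?_, ?_⟩
  · refine (Finset.card_le_card (t := {i}) fun k hk => ?_).trans (by simp)
    by_contra hki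
    simp only [Finset.mem_singleton] at hki
    simp [Pi.single_eq_of_ne hki] at hk
  · rw [Finset.sum_eq_single i (fun k _ hk => by simp [Pi.single_eq_of_ne hk]) (by simp),
      Pi.single_eq_same]
    exact hi

open Classical in
theorem card_filter_add_ne_zero_le (f g : ι → ℝ) :
    (Finset.univ.filter fun i => f i + g i ≠ 0).card ≤
      (Finset.univ.filter fun i => f i ≠ 0).card
        + (Finset.univ.filter fun i => g i ≠ 0).card := by
  refine (Finset.card_le_card fun i hi => ?_).trans (Finset.card_union_le _ _)
  simp only [Finset.mem_union, Finset.mem_filter, Finset.mem_univ, true_and] at hi ⊢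
  by_contra! h
  simp [h] at hi

open Classical in
/-- Maurey's sampling argument, derandomized. -/
theorem exists_norm_add_sum_smul_sub_natCast_smul_sq_le (v : ι → E) {B : ℝ}
    (hv : ∀ j, ‖v j‖ ^ 2 ≤ B ^ 2) (ζ : ι → ℝ) (e : E) (k : ℕ) :
    ∃ d : ι → ℝ, (Finset.univ.filter fun i => d i ≠ 0).card ≤ k ∧
      ‖e + (∑ i, d i • v i - (k : ℝ) • ∑ i, ζ i • v i)‖ ^ 2 ≤
        ‖e‖ ^ 2 + k * (B ^ 2 * (∑ i, |ζ i|) ^ 2) := by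
  induction k with
  | zero => exact ⟨0, by simp⟩
  | succ k ih =>
    obtain ⟨d, hd, hle⟩ := ih
    obtain ⟨c, hc, hle'⟩ := exists_norm_add_sum_smul_sub_sum_sq_le v hv ζ
      (e + (∑ i, d i • v i - (k : ℝ) • ∑ i, ζ i • v i))
    refine ⟨fun i => d i + c i, (card_filter_add_ne_zero_le d c).trans (by omega), ?_⟩
    have heq : e + (∑ i, (d i + c i) • v i - ((k + 1 : ℕ) : ℝ) • ∑ i, ζ i • v i)
        = e + (∑ i, d i • v i - (k : ℝ) • ∑ i, ζ i • v i)
          + (∑ i, c i • v i - ∑ i, ζ i • v i) := by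
      simp only [add_smul, Finset.sum_add_distrib, Nat.cast_add, Nat.cast_one, one_smul]
      abel
    rw [heq]
    push_cast
    linarith

end Maurey

theorem stmt_19
    (n M : ℕ) (B : ℝ) (hB : 0 < B)
    (μs : Fin M → EuclideanSpace ℝ (Fin n)) (hμs : ∀ j, ‖μs j‖ ^ 2 ≤ B ^ 2)
    (μ : EuclideanSpace ℝ (Fin n))
    (q : ℝ) (hq : q ∈ Set.Ioc (0 : ℝ) 1)
    (θ : Fin M → ℝ)
    (m : ℕ) (hm1 : 1 ≤ m) (hmM : 2 * m ≤ M) :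
    ∃ θm : Fin M → ℝ,
      (Finset.univ.filter fun i => θm i ≠ 0).card ≤ 2 * m ∧
      ‖(∑ j, θm j • μs j) - μ‖ ^ 2 ≤
        ‖(∑ j, θ j • μs j) - μ‖ ^ 2
          + B ^ 2 * ((∑ j, |θ j| ^ q) ^ (1 / q)) ^ (2 : ℕ) * (m : ℝ) ^ (1 - 2 / q) := by
  have hm0 : (0 : ℝ) < m := by exact_mod_cast hm1
  obtain ⟨S, hS, hmax⟩ := exists_card_eq_forall_notMem_le (fun j => |θ j|) m
    (by rw [Fintype.card_fin]; omega)
  have htail := sum_abs_compl_le_of_forall_notMem_le θ hq hm1 hS hmax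
  set ζ : Fin M → ℝ := fun j => if j ∈ S then 0 else θ j with hζ
  set η : Fin M → ℝ := fun j => if j ∈ S then θ j else 0 with hη
  have hsplit : ∑ j, θ j • μs j = ∑ j, η j • μs j + ∑ j, ζ j • μs j := by
    rw [← Finset.sum_add_distrib]
    refine Finset.sum_congr rfl fun j _ => ?_
    by_cases hj : j ∈ S <;> simp [hζ, hη, hj]
  have hζsum : ∑ j, |ζ j| = ∑ j ∈ Sᶜ, |θ j| := by
    rw [← Finset.sum_add_sum_compl S, Finset.sum_eq_zero, zero_add]
    · refine Finset.sum_congr rfl fun j hj => ?_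
      simp [hζ, Finset.mem_compl.1 hj]
    · intro j hj
      simp [hζ, hj]
  obtain ⟨d, hd, hle⟩ := exists_norm_add_sum_smul_sub_natCast_smul_sq_le μs hμs ζ
    ((m : ℝ) • ((∑ j, θ j • μs j) - μ)) m
  refine ⟨fun j => η j + (m : ℝ)⁻¹ * d j, ?_, ?_⟩
  · have h1 : (Finset.univ.filter fun i => η i ≠ 0).card ≤ m := by
      rw [← hS]
      refine Finset.card_le_card fun i hi => ?_
      by_contra h
      simp [hη, h] at hi
    have h2 : (Finset.univ.filter fun i => (m : ℝ)⁻¹ * d i ≠ 0).card ≤ m := by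
      refine le_trans (Finset.card_le_card fun i hi => ?_) hd
      simp only [Finset.mem_filter, Finset.mem_univ, true_and] at hi ⊢
      exact right_ne_zero_of_mul hi
    have h3 := card_filter_add_ne_zero_le η fun i => (m : ℝ)⁻¹ * d i
    refine le_trans ?_ (h3.trans ?_)
    · exact le_of_eq (by congr)
    · calc _ ≤ m + m := add_le_add (le_trans (le_of_eq (by congr)) h1)
            (le_trans (le_of_eq (by congr)) h2)
        _ = 2 * m := by ring
  · have hsmul : (m : ℝ) • (∑ j, θ j • μs j - μ) + (∑ i, d i • μs i - (m : ℝ) • ∑ i, ζ i • μs i)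
        = (m : ℝ) • ((∑ j, (η j + (m : ℝ)⁻¹ * d j) • μs j) - μ) := by
      simp only [add_smul, Finset.sum_add_distrib, mul_smul, ← Finset.smul_sum, hsplit, smul_sub,
        smul_add, smul_inv_smul₀ hm0.ne']
      abel
    rw [hsmul, norm_smul, norm_smul, mul_pow, mul_pow, Real.norm_eq_abs, sq_abs, hζsum] at hle
    set t := ∑ j ∈ Sᶜ, |θ j|
    set N := (∑ j, |θ j| ^ q) ^ (1 / q)
    have ht0 : 0 ≤ t := Finset.sum_nonneg fun j _ => abs_nonneg _
    have hsq : t ^ 2 ≤ N ^ 2 * (m : ℝ) ^ (1 - 2 / q) * m := by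
      refine (pow_le_pow_left₀ ht0 htail 2).trans_eq ?_
      rw [mul_pow, mul_assoc, ← Real.rpow_natCast, ← Real.rpow_natCast, ← Real.rpow_mul hm0.le,
        ← Real.rpow_add_one hm0.ne']
      congr 2
      push_cast
      ring
    have hfin : (m : ℝ) ^ 2 * ‖(∑ j, (η j + (m : ℝ)⁻¹ * d j) • μs j) - μ‖ ^ 2 ≤
        (m : ℝ) ^ 2 * (‖(∑ j, θ j • μs j) - μ‖ ^ 2 + B ^ 2 * N ^ 2 * (m : ℝ) ^ (1 - 2 / q)) := by
      refine hle.trans ?_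
      have := mul_le_mul_of_nonneg_left hsq (by positivity : 0 ≤ m * B ^ 2)
      nlinarith
    exact le_of_mul_le_mul_left hfin (by positivity)
end
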